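/- arXiv:2009.04698 — 2 statements merged into one kernel-verified Lean document; each statement's English description precedes it below -/
import Mathlib

section
/- Let δ ≥ 0 and let H be a proper δ-hyperbolic Busemann space with a fixed base point w ∈ H and boundary point a ∈ ∂H. Let V : ℝ → H be a path parametrised by arclength. Then V is a vertical geodesic if and only if there exists a constant c ∈ ℝ such that h(V(t)) = t + c for all t ∈ ℝ. -/
open Set Filter
open scoped ENNReal NNReal

noncomputable section

namespace HP

variable {H : Type*} [MetricSpace H]

/-- `γ` restricted to `I` is an arclength-parametrised (isometric) geodesic. -/
def IsGeodesicOn (γ : ℝ → H) (I : Set ℝ) : Prop :=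
  ∀ s ∈ I, ∀ t ∈ I, dist (γ s) (γ t) = |s - t|

/-- A geodesic line of `H`. -/
def IsGeodesicLine (γ : ℝ → H) : Prop := IsGeodesicOn γ Set.univ

/-- A geodesic ray of `H`, parametrised on `[0,∞)`. -/
def IsGeodesicRay (γ : ℝ → H) : Prop := IsGeodesicOn γ (Set.Ici 0)

/-- A geodesic ray starting at `w`. -/
def IsRayFrom (w : H) (γ : ℝ → H) : Prop := IsGeodesicRay γ ∧ γ 0 = w

/-- A geodesic segment from `x` to `y`, parametrised on `[0, dist x y]`. -/
def IsGeodSegment (γ : ℝ → H) (x y : H) : Prop :=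
  IsGeodesicOn γ (Set.Icc 0 (dist x y)) ∧ γ 0 = x ∧ γ (dist x y) = y

/-- The traces on `[0,∞)` of two rays are at finite Hausdorff distance. -/
def FinHausRays (γ₁ γ₂ : ℝ → H) : Prop :=
  ∃ C : ℝ, (∀ s : ℝ, 0 ≤ s → ∃ t : ℝ, 0 ≤ t ∧ dist (γ₁ s) (γ₂ t) ≤ C) ∧
           (∀ t : ℝ, 0 ≤ t → ∃ s : ℝ, 0 ≤ s ∧ dist (γ₁ s) (γ₂ t) ≤ C)

/-- A geodesic metric space: any two points are joined by a geodesic segment. -/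
def GeodesicSpace (H : Type*) [MetricSpace H] : Prop :=
  ∀ x y : H, ∃ γ : ℝ → H, IsGeodSegment γ x y

/-- `δ`-hyperbolicity: geodesic space all of whose geodesic triangles are `δ`-slim,
i.e. each side is contained in the `δ`-neighbourhood of the union of the other two. -/
def DeltaHyperbolic (H : Type*) [MetricSpace H] (δ : ℝ) : Prop :=
  GeodesicSpace H ∧
  ∀ x y z : H, ∀ γ₁ γ₂ γ₃ : ℝ → H,
    IsGeodSegment γ₁ x y → IsGeodSegment γ₂ y z → IsGeodSegment γ₃ z x →
    ∀ s ∈ Set.Icc (0:ℝ) (dist x y),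
      ∃ u ∈ γ₂ '' Set.Icc (0:ℝ) (dist y z) ∪ γ₃ '' Set.Icc (0:ℝ) (dist z x),
        dist (γ₁ s) u ≤ δ

/-- A Busemann space: geodesic, and the distance between any two
arclength-parametrised geodesics is a convex function. -/
def BusemannSpace (H : Type*) [MetricSpace H] : Prop :=
  GeodesicSpace H ∧
  ∀ (a b a' b' : ℝ) (γ γ' : ℝ → H),
    IsGeodesicOn γ (Set.Icc a b) → IsGeodesicOn γ' (Set.Icc a' b') →
    ConvexOn ℝ (Set.Icc a b ×ˢ Set.Icc a' b')
      (fun p : ℝ × ℝ => dist (γ p.1) (γ' p.2))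

/-- Geodesic completeness: every geodesic segment extends to a geodesic line. -/
def GeodesicallyComplete (H : Type*) [MetricSpace H] : Prop :=
  ∀ (a b : ℝ) (γ : ℝ → H), a ≤ b → IsGeodesicOn γ (Set.Icc a b) →
    ∃ γ' : ℝ → H, IsGeodesicLine γ' ∧ ∀ t ∈ Set.Icc a b, γ' t = γ t

/-- The Busemann function with respect to the boundary point represented by the
geodesic ray `aRep` and the base point `w`. -/
def busemann (w : H) (aRep : ℝ → H) (x : H) : ℝ :=
  sSup { b : ℝ | ∃ k : ℝ → H, IsRayFrom w k ∧ FinHausRays aRep k ∧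
    b = Filter.limsup (fun t => dist x (k t) - t) Filter.atTop }

/-- The height function: minus the Busemann function. -/
def height (w : H) (aRep : ℝ → H) (x : H) : ℝ := - busemann w aRep x

/-- A vertical geodesic (forward oriented): a geodesic line whose height tends to `+∞`. -/
def IsVerticalGeodesic (w : H) (aRep : ℝ → H) (V : ℝ → H) : Prop :=
  IsGeodesicLine V ∧ Tendsto (fun t => height w aRep (V t)) atTop atTop

/-- A vertical geodesic line (either orientation): a geodesic line whose image lies
in the boundary class, i.e. whose height tends to `+∞` along one of its ends. -/
def IsVerticalGeodesicLine (w : H) (aRep : ℝ → H) (V : ℝ → H) : Prop :=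
  IsGeodesicLine V ∧
    (Tendsto (fun t => height w aRep (V t)) atTop atTop ∨
     Tendsto (fun t => height w aRep (V t)) atBot atTop)

/-- A vertical geodesic parametrised by its height: `h(V(t)) = t` for all `t`. -/
def VertParam (w : H) (aRep : ℝ → H) (V : ℝ → H) : Prop :=
  IsGeodesicLine V ∧ ∀ t : ℝ, height w aRep (V t) = t

/-- Height difference `Δh(x,y)`. -/
def dh (w : H) (aRep : ℝ → H) (x y : H) : ℝ :=
  |height w aRep x - height w aRep y|

/-- Relative distance `d_r(x,y) = d(x,y) - Δh(x,y)`. -/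
def dr (w : H) (aRep : ℝ → H) (x y : H) : ℝ := dist x y - dh w aRep x y

/-- Maximal height `h⁺` of a path along the parameter set `I`. -/
def hplusOn (w : H) (aRep : ℝ → H) (γ : ℝ → H) (I : Set ℝ) : ℝ :=
  sSup ((fun t => height w aRep (γ t)) '' I)

/-- Minimal height `h⁻` of a path along the parameter set `I`. -/
def hminusOn (w : H) (aRep : ℝ → H) (γ : ℝ → H) (I : Set ℝ) : ℝ :=
  sInf ((fun t => height w aRep (γ t)) '' I)

/-- A path parametrised by arclength: the length of the piece on `[s,t]` equals `t - s`. -/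
def ArclengthPath (V : ℝ → H) : Prop :=
  ∀ s t : ℝ, s ≤ t → eVariationOn V (Set.Icc s t) = ENNReal.ofReal (t - s)

/-- An admissible norm on `ℝ²`: a norm with `N(1,1) = 1` and `N(a,b) ≥ (a+b)/2`. -/
structure AdmNorm where
  toFun : ℝ × ℝ → ℝ
  eq_zero_iff : ∀ v : ℝ × ℝ, toFun v = 0 ↔ v = 0
  smul_eq : ∀ (c : ℝ) (v : ℝ × ℝ), toFun (c • v) = |c| * toFun v
  add_le : ∀ v w : ℝ × ℝ, toFun (v + w) ≤ toFun v + toFun w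
  one_one : toFun (1, 1) = 1
  adm : ∀ a b : ℝ, (a + b) / 2 ≤ toFun (a, b)

/-- `C` is a comparison constant `C_N` for the admissible norm `N`:
`C ≥ 1` and `N(a,b) ≤ C(a+b)/2` for all `a,b ≥ 0`. -/
def AdmNorm.BoundConst (N : AdmNorm) (C : ℝ) : Prop :=
  1 ≤ C ∧ ∀ a b : ℝ, 0 ≤ a → 0 ≤ b → N.toFun (a, b) ≤ C * (a + b) / 2

variable {Hp Hq : Type*} [MetricSpace Hp] [MetricSpace Hq]

/-- Membership in the horospherical product: `h_p(x_p) + h_q(x_q) = 0`. -/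
def inHoro (wp : Hp) (ap : ℝ → Hp) (wq : Hq) (aq : ℝ → Hq) (z : Hp × Hq) : Prop :=
  height wp ap z.1 + height wq aq z.2 = 0

/-- The `N`-length of a path in `Hp × Hq`: supremum over finite monotone
subdivisions of the sums of the `N(d_p, d_q)`-distances. -/
def lN (Nf : ℝ × ℝ → ℝ) (γ : ℝ → Hp × Hq) (s : Set ℝ) : ℝ≥0∞ :=
  ⨆ p : ℕ × { u : ℕ → ℝ // Monotone u ∧ ∀ i, u i ∈ s },
    ∑ i ∈ Finset.range p.1,
      ENNReal.ofReal (Nf (dist (γ (p.2.1 (i+1))).1 (γ (p.2.1 i)).1,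
                          dist (γ (p.2.1 (i+1))).2 (γ (p.2.1 i)).2))

/-- The `N`-path metric: infimum of `N`-lengths of connected paths staying in the
horospherical product and joining the two points. -/
def dHN (Nf : ℝ × ℝ → ℝ) (mem : Hp × Hq → Prop) (x y : Hp × Hq) : ℝ≥0∞ :=
  ⨅ (T : ℝ) (_ : 0 ≤ T) (γ : ℝ → Hp × Hq) (_ : ContinuousOn γ (Set.Icc 0 T))
    (_ : ∀ t ∈ Set.Icc (0:ℝ) T, mem (γ t)) (_ : γ 0 = x) (_ : γ T = y),
    lN Nf γ (Set.Icc 0 T)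

/-- A geodesic of the horospherical product with respect to the `N`-path metric,
parametrised (by arclength) on `I` and staying in the product. -/
def IsHNGeodesicOn (Nf : ℝ × ℝ → ℝ) (mem : Hp × Hq → Prop)
    (α : ℝ → Hp × Hq) (I : Set ℝ) : Prop :=
  (∀ t ∈ I, mem (α t)) ∧
  ∀ s ∈ I, ∀ t ∈ I, dHN Nf mem (α s) (α t) = ENNReal.ofReal |s - t|

/-- A vertical geodesic of the horospherical product, parametrised by its height. -/
def IsHNVerticalLine (Nf : ℝ × ℝ → ℝ) (mem : Hp × Hq → Prop)
    (wp : Hp) (ap : ℝ → Hp) (V : ℝ → Hp × Hq) : Prop :=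
  IsHNGeodesicOn Nf mem V Set.univ ∧ ∀ t : ℝ, height wp ap (V t).1 = t

/-- Maximal height `h⁺` of a path of the horospherical product. -/
def hplusH (wp : Hp) (ap : ℝ → Hp) (γ : ℝ → Hp × Hq) (I : Set ℝ) : ℝ :=
  sSup ((fun t => height wp ap (γ t).1) '' I)

/-- Minimal height `h⁻` of a path of the horospherical product. -/
def hminusH (wp : Hp) (ap : ℝ → Hp) (γ : ℝ → Hp × Hq) (I : Set ℝ) : ℝ :=
  sInf ((fun t => height wp ap (γ t).1) '' I)

/-- `H_p`-type path at scale `κ`: the first component stays `κ`-close to a geodesic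
of `H_p` and the second component stays `κ`-close to a vertical geodesic of `H_q`. -/
def IsHpType (wq : Hq) (aq : ℝ → Hq) (κ : ℝ) (α : ℝ → Hp × Hq) : Prop :=
  (∃ g : ℝ → Hp, IsGeodesicLine g ∧ ∀ t : ℝ, ∃ s : ℝ, dist (α t).1 (g s) ≤ κ) ∧
  (∃ v : ℝ → Hq, IsVerticalGeodesicLine wq aq v ∧ ∀ t : ℝ, ∃ s : ℝ, dist (α t).2 (v s) ≤ κ)

/-- `H_q`-type path at scale `κ`. -/
def IsHqType (wp : Hp) (ap : ℝ → Hp) (κ : ℝ) (α : ℝ → Hp × Hq) : Prop :=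
  (∃ g : ℝ → Hq, IsGeodesicLine g ∧ ∀ t : ℝ, ∃ s : ℝ, dist (α t).2 (g s) ≤ κ) ∧
  (∃ v : ℝ → Hp, IsVerticalGeodesicLine wp ap v ∧ ∀ t : ℝ, ∃ s : ℝ, dist (α t).1 (v s) ≤ κ)

/-- Finite Hausdorff distance on `[0,∞)` between two rays, for a generalized
(`ℝ≥0∞`-valued) distance `dd`. -/
def HNFinHaus {X : Type*} (dd : X → X → ℝ≥0∞) (α β : ℝ → X) : Prop :=
  ∃ C : ℝ, (∀ s : ℝ, 0 ≤ s → ∃ t : ℝ, 0 ≤ t ∧ dd (α s) (β t) ≤ ENNReal.ofReal C) ∧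
           (∀ t : ℝ, 0 ≤ t → ∃ s : ℝ, 0 ≤ s ∧ dd (α s) (β t) ≤ ENNReal.ofReal C)

theorem finHaus_equivalence (H : Type*) [MetricSpace H] :
    Equivalence (fun γ₁ γ₂ : {γ : ℝ → H // IsGeodesicRay γ} => FinHausRays γ₁.1 γ₂.1) := by
  constructor
  · intro γ
    exact ⟨0, fun s hs => ⟨s, hs, by simp⟩, fun t ht => ⟨t, ht, by simp⟩⟩
  · rintro γ₁ γ₂ ⟨C, h1, h2⟩
    refine ⟨C, fun s hs => ?_, fun t ht => ?_⟩
    · obtain ⟨u, hu, hd⟩ := h2 s hs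
      exact ⟨u, hu, by rwa [dist_comm]⟩
    · obtain ⟨u, hu, hd⟩ := h1 t ht
      exact ⟨u, hu, by rwa [dist_comm]⟩
  · rintro γ₁ γ₂ γ₃ ⟨C, h1, h2⟩ ⟨D, g1, g2⟩
    refine ⟨C + D, fun s hs => ?_, fun t ht => ?_⟩
    · obtain ⟨u, hu, hd⟩ := h1 s hs
      obtain ⟨v, hv, he⟩ := g1 u hu
      exact ⟨v, hv, (dist_triangle _ (γ₂.1 u) _).trans (add_le_add hd he)⟩
    · obtain ⟨u, hu, hd⟩ := g2 t ht
      obtain ⟨v, hv, he⟩ := h2 u hu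
      exact ⟨v, hv, (dist_triangle _ (γ₂.1 u) _).trans (add_le_add he hd)⟩

/-- The setoid of geodesic rays up to finite Hausdorff distance. -/
instance raySetoid (H : Type*) [MetricSpace H] : Setoid {γ : ℝ → H // IsGeodesicRay γ} :=
  ⟨fun γ₁ γ₂ => FinHausRays γ₁.1 γ₂.1, finHaus_equivalence H⟩

/-- The Gromov boundary: equivalence classes of geodesic rays at finite
Hausdorff distance. -/
abbrev Bdry (H : Type*) [MetricSpace H] := Quotient (raySetoid H)

/-- The boundary point determined by a geodesic ray. -/
def bdryPt {H : Type*} [MetricSpace H] (γ : ℝ → H) (h : IsGeodesicRay γ) : Bdry H :=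
  Quotient.mk (raySetoid H) ⟨γ, h⟩

/-- The set `((∂H_p ∖ {a_p}) × {a_q}) ∪ ({a_p} × (∂H_q ∖ {a_q}))`. -/
def bdryTarget {Hp Hq : Type*} [MetricSpace Hp] [MetricSpace Hq]
    (ap : ℝ → Hp) (hap : IsGeodesicRay ap)
    (aq : ℝ → Hq) (haq : IsGeodesicRay aq) : Set (Bdry Hp × Bdry Hq) :=
  ((({bdryPt ap hap} : Set (Bdry Hp))ᶜ ×ˢ ({bdryPt aq haq} : Set (Bdry Hq))) ∪
   (({bdryPt ap hap} : Set (Bdry Hp)) ×ˢ ({bdryPt aq haq} : Set (Bdry Hq))ᶜ))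

theorem IsRayFrom.eq_of_finHausRays {H : Type*} [MetricSpace H] (hB : BusemannSpace H)
    {w : H} {a k : ℝ → H} (ha : IsRayFrom w a) (hk : IsRayFrom w k) (hak : FinHausRays a k)
    {t : ℝ} (ht : 0 ≤ t) : a t = k t := by
  obtain ⟨C, hC, -⟩ := hak
  have bound : ∀ s : ℝ, 0 ≤ s → dist (a s) (k s) ≤ 2 * C := by
    intro s hs
    obtain ⟨u, hu, hd⟩ := hC s hs
    have h1 : dist (a s) w = s := by
      rw [← ha.2, ha.1 s hs 0 self_mem_Ici, sub_zero, abs_of_nonneg hs]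
    have h2 : dist (k u) w = u := by
      rw [← hk.2, hk.1 u hu 0 self_mem_Ici, sub_zero, abs_of_nonneg hu]
    have h3 : dist (k u) (k s) = |u - s| := hk.1 u hu s hs
    have h4 : |u - s| ≤ C := by
      have := abs_dist_sub_le (k u) (a s) w
      rw [h1, h2, dist_comm] at this
      exact this.trans hd
    linarith [dist_triangle (a s) (k u) (k s)]
  have scaled : ∀ s : ℝ, 0 < s → t ≤ s → s * dist (a t) (k t) ≤ t * (2 * C) := by
    intro s hs hts
    have hconv := hB.2 0 s 0 s a k
      (fun x hx y hy => ha.1 x hx.1 y hy.1) (fun x hx y hy => hk.1 x hx.1 y hy.1)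
    have hq : 0 ≤ t / s := by positivity
    have hp : 0 ≤ 1 - t / s := by
      rw [sub_nonneg, div_le_one hs]; exact hts
    have h := hconv.2 (x := ((0 : ℝ), (0 : ℝ))) (y := (s, s))
      ⟨⟨le_rfl, hs.le⟩, ⟨le_rfl, hs.le⟩⟩ ⟨⟨hs.le, le_rfl⟩, ⟨hs.le, le_rfl⟩⟩ hp hq (by ring)
    have hts' : t / s * s = t := by field_simp
    simp only [Prod.smul_mk, Prod.mk_add_mk, smul_eq_mul, mul_zero, zero_add, hts', ha.2, hk.2,
      dist_self] at h
    calc s * dist (a t) (k t) ≤ s * (t / s * dist (a s) (k s)) := by gcongr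
      _ = t * dist (a s) (k s) := by field_simp
      _ ≤ t * (2 * C) := by gcongr; exact bound s hs.le
  by_contra hne
  have hpos : 0 < dist (a t) (k t) := dist_pos.2 hne
  obtain ⟨s, hs⟩ := ((tendsto_id.atTop_mul_const hpos).eventually_gt_atTop (t * (2 * C))).and
    ((eventually_gt_atTop 0).and (eventually_ge_atTop t)) |>.exists
  exact absurd (scaled s hs.2.1 hs.2.2) (not_le.2 hs.1)

/-- In a Busemann space the height is the limit of `t - d(x, a(t))`. -/
theorem tendsto_height {H : Type*} [MetricSpace H] (hB : BusemannSpace H)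
    {w : H} {a : ℝ → H} (ha : IsRayFrom w a) (x : H) :
    Tendsto (fun t => t - dist x (a t)) atTop (nhds (height w a x)) := by
  have hset : {b : ℝ | ∃ k : ℝ → H, IsRayFrom w k ∧ FinHausRays a k ∧
      b = limsup (fun t => dist x (k t) - t) atTop} =
      {limsup (fun t => dist x (a t) - t) atTop} := by
    ext b
    simp only [mem_ofPred_eq, mem_singleton_iff]
    constructor
    · rintro ⟨k, hk, hak, rfl⟩
      refine limsup_congr ?_
      filter_upwards [eventually_ge_atTop 0] with t ht
      rw [ha.eq_of_finHausRays hB hk hak ht]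
    · rintro rfl
      exact ⟨a, ha, ⟨0, fun s hs => ⟨s, hs, by simp⟩, fun t ht => ⟨t, ht, by simp⟩⟩, rfl⟩
  have hmono : Monotone (fun t => max t 0 - dist x (a (max t 0))) := by
    intro s t hst
    have h0 : max s 0 ≤ max t 0 := max_le_max_right 0 hst
    have h1 : dist (a (max t 0)) (a (max s 0)) = max t 0 - max s 0 := by
      rw [ha.1 _ (le_max_right t 0) _ (le_max_right s 0), abs_of_nonneg (by linarith)]
    have h2 := dist_triangle x (a (max s 0)) (a (max t 0))
    rw [dist_comm (a (max s 0))] at h2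
    simp only
    linarith
  have hbdd : BddAbove (range (fun t => max t 0 - dist x (a (max t 0)))) := by
    refine ⟨dist x w, ?_⟩
    rintro _ ⟨t, rfl⟩
    have h1 : dist (a (max t 0)) w = max t 0 := by
      rw [← ha.2, ha.1 _ (le_max_right t 0) _ self_mem_Ici, sub_zero,
        abs_of_nonneg (le_max_right t 0)]
    have h2 := dist_triangle (a (max t 0)) x w
    rw [dist_comm (a (max t 0)) x] at h2
    simp only
    linarith
  have hlim : Tendsto (fun t => t - dist x (a t)) atTop
      (nhds (⨆ t, (max t 0 - dist x (a (max t 0))))) := by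
    refine (tendsto_atTop_ciSup hmono hbdd).congr' ?_
    filter_upwards [eventually_ge_atTop 0] with t ht
    rw [max_eq_left ht]
  have hneg := hlim.neg
  simp only [neg_sub] at hneg
  rw [height, busemann, hset, csSup_singleton, hneg.limsup_eq, neg_neg]
  exact hlim

theorem height_sub_le_dist {H : Type*} [MetricSpace H] (hB : BusemannSpace H)
    {w : H} {a : ℝ → H} (ha : IsRayFrom w a) (x y : H) :
    height w a x - height w a y ≤ dist x y := by
  refine le_of_tendsto' ((tendsto_height hB ha x).sub (tendsto_height hB ha y)) fun t => ?_
  linarith [dist_triangle_left y (a t) x]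

theorem concaveOn_height_comp {H : Type*} [MetricSpace H] (hB : BusemannSpace H)
    {w : H} {a : ℝ → H} (ha : IsRayFrom w a) {V : ℝ → H} (hV : IsGeodesicLine V) :
    ConcaveOn ℝ univ (fun t => height w a (V t)) := by
  refine ⟨convex_univ, fun x _ y _ p q hp hq hpq => ?_⟩
  simp only [smul_eq_mul]
  refine le_of_tendsto_of_tendsto
    (((tendsto_height hB ha (V x)).const_mul p).add ((tendsto_height hB ha (V y)).const_mul q))
    (tendsto_height hB ha (V (p * x + q * y))) ?_
  filter_upwards [eventually_ge_atTop 0] with s hs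
  have h := (hB.2 (min x y) (max x y) s s V a
    (fun u _ v _ => hV u trivial v trivial)
    (fun u hu v hv => ha.1 u (hs.trans hu.1) v (hs.trans hv.1))).2
    (x := (x, s)) (y := (y, s))
    ⟨⟨min_le_left _ _, le_max_left _ _⟩, ⟨le_rfl, le_rfl⟩⟩
    ⟨⟨min_le_right _ _, le_max_right _ _⟩, ⟨le_rfl, le_rfl⟩⟩ hp hq hpq
  simp only [Prod.smul_mk, Prod.mk_add_mk, smul_eq_mul, ← add_mul, hpq, one_mul] at h
  have hs' : p * s + q * s = s := by rw [← add_mul, hpq, one_mul]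
  linarith

theorem IsGeodSegment.dist_add_dist_le {H : Type*} [MetricSpace H] {γ : ℝ → H} {x y z u : H}
    {δ : ℝ} (hγ : IsGeodSegment γ x y) (hu : u ∈ γ '' Icc 0 (dist x y)) (hz : dist z u ≤ δ) :
    dist x z + dist z y ≤ dist x y + 2 * δ := by
  obtain ⟨r, hr, rfl⟩ := hu
  have h1 : dist x (γ r) = r := by
    have := hγ.1 0 ⟨le_rfl, dist_nonneg⟩ r hr
    rwa [hγ.2.1, zero_sub, abs_neg, abs_of_nonneg hr.1] at this
  have h2 : dist (γ r) y = dist x y - r := by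
    have := hγ.1 r hr (dist x y) ⟨dist_nonneg, le_rfl⟩
    rwa [hγ.2.2, abs_sub_comm, abs_of_nonneg (by linarith [hr.2])] at this
  linarith [dist_triangle_right x z (γ r), dist_triangle z (γ r) y]

/-- A concave function tending to `+∞` at `+∞` is nondecreasing. -/
theorem ConcaveOn.monotone_of_tendsto_atTop {f : ℝ → ℝ} (hf : ConcaveOn ℝ univ f)
    (hlim : Tendsto f atTop atTop) : Monotone f := by
  intro u t hut
  rcases hut.eq_or_lt with rfl | hut
  · rfl
  obtain ⟨r, hr, htr⟩ := ((hlim.eventually_ge_atTop (f t)).and (eventually_gt_atTop t)).exists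
  have h := hf.slope_anti_adjacent (mem_univ u) (mem_univ r) hut htr
  have h0 : 0 ≤ (f r - f t) / (r - t) := div_nonneg (by linarith) (by linarith)
  have h1 := mul_nonneg (h0.trans h) (sub_pos.2 hut).le
  rw [div_mul_cancel₀ _ (sub_pos.2 hut).ne'] at h1
  linarith

/-- A concave function that stays above a line of slope `m` near `+∞` grows everywhere with slope
at least `m`. -/
theorem ConcaveOn.mul_sub_le_of_forall_le {f : ℝ → ℝ} (hf : ConcaveOn ℝ univ f) {m C : ℝ}
    (hC : ∀ u, 0 ≤ u → m * u + C ≤ f u) {p q : ℝ} (hpq : p < q) :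
    m * (q - p) ≤ f q - f p := by
  by_contra! hlt
  have hd : 0 < q - p := sub_pos.2 hpq
  have hm : (f q - f p) / (q - p) < m := (div_lt_iff₀ hd).2 hlt
  set n := (f q - f p) / (q - p)
  obtain ⟨r, hr, hr0, hqr⟩ := ((tendsto_id.atTop_mul_const (sub_pos.2 hm)).eventually_gt_atTop
    (f q - n * q - C)).and ((eventually_ge_atTop 0).and (eventually_gt_atTop q)) |>.exists
  have h := hf.slope_anti_adjacent (mem_univ p) (mem_univ r) hpq hqr
  rw [div_le_iff₀ (sub_pos.2 hqr)] at h
  have h2 := hC r hr0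
  change f r - f q ≤ n * (r - q) at h
  simp only [id] at hr
  nlinarith

/-- Along a geodesic line whose height tends to `+∞`, the height grows with slope one up to an
additive constant. -/
theorem IsVerticalGeodesic.le_height {H : Type*} [MetricSpace H] {δ : ℝ}
    (hH : DeltaHyperbolic H δ) (hB : BusemannSpace H)
    {w : H} {a : ℝ → H} (ha : IsRayFrom w a) {V : ℝ → H} (hV : IsVerticalGeodesic w a V)
    (hδ : 0 ≤ δ) {u : ℝ} (hu : 0 ≤ u) :
    height w a (V 0) + u - 2 * δ ≤ height w a (V u) := by
  by_contra! hlt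
  have hmono := ConcaveOn.monotone_of_tendsto_atTop (concaveOn_height_comp hB ha hV.1) hV.2
  obtain ⟨t, ht⟩ : ∃ t, t = u + 2 * δ + 1 := ⟨_, rfl⟩
  have hut : u ≤ t := by linarith
  have dist_V : ∀ {p q : ℝ}, p ≤ q → dist (V p) (V q) = q - p := fun {p q} hpq => by
    rw [hV.1 p trivial q trivial, abs_sub_comm, abs_of_nonneg (sub_nonneg.2 hpq)]
  have hV0t : dist (V 0) (V t) = t := by rw [dist_V (hu.trans hut), sub_zero]
  have hseg : IsGeodSegment V (V 0) (V t) :=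
    ⟨fun p _ q _ => hV.1 p trivial q trivial, rfl, by rw [hV0t]⟩
  have hlt' := (tendsto_height hB ha (V u)).eventually_lt
    (((tendsto_height hB ha (V 0)).add_const u).sub_const (2 * δ)) hlt
  have hdesc : height w a (V t) ≤ height w a (V u) - 1 := by
    refine le_of_tendsto_of_tendsto (tendsto_height hB ha (V t))
      ((tendsto_height hB ha (V u)).sub_const 1) ?_
    filter_upwards [hlt'] with s hs
    obtain ⟨γ₂, h₂⟩ := hH.1 (V t) (a s)
    obtain ⟨γ₃, h₃⟩ := hH.1 (a s) (V 0)
    obtain ⟨z, hz | hz, hdz⟩ := hH.2 _ _ _ V γ₂ γ₃ hseg h₂ h₃ u ⟨hu, by rw [hV0t]; exact hut⟩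
    · have h := h₂.dist_add_dist_le hz hdz
      rw [dist_comm (V t) (V u), dist_V hut] at h
      linarith
    · have h := h₃.dist_add_dist_le hz hdz
      rw [dist_comm (V u) (V 0), dist_V hu, dist_comm (a s), dist_comm (a s)] at h
      linarith
  linarith [hmono hut]

theorem ArclengthPath.dist_le {H : Type*} [MetricSpace H] {V : ℝ → H} (hV : ArclengthPath V)
    {s t : ℝ} (hst : s ≤ t) : dist (V s) (V t) ≤ t - s := by
  have h := eVariationOn.edist_le V (left_mem_Icc.2 hst) (right_mem_Icc.2 hst)
  rwa [hV s t hst, edist_dist, ENNReal.ofReal_le_ofReal_iff (sub_nonneg.2 hst)] at h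

/-- In a proper δ-hyperbolic Busemann space, an arclength-parametrised
path is a vertical geodesic iff its height is `t + c`. -/
theorem statement1 {H : Type*} [MetricSpace H] [ProperSpace H]
    (δ : ℝ) (hδ : 0 ≤ δ) (hH : DeltaHyperbolic H δ) (hB : BusemannSpace H)
    (w : H) (a : ℝ → H) (ha : IsRayFrom w a)
    (V : ℝ → H) (hV : ArclengthPath V) :
    IsVerticalGeodesic w a V ↔ ∃ c : ℝ, ∀ t : ℝ, height w a (V t) = t + c := by
  constructor
  · intro h
    have hconc := concaveOn_height_comp hB ha h.1
    have hgrow : ∀ p q : ℝ, p < q → height w a (V q) - height w a (V p) = q - p := by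
      intro p q hpq
      refine le_antisymm ?_ ?_
      · have := height_sub_le_dist hB ha (V q) (V p)
        rwa [h.1 q trivial p trivial, abs_of_pos (sub_pos.2 hpq)] at this
      · have := ConcaveOn.mul_sub_le_of_forall_le hconc (m := 1)
          (C := height w a (V 0) - 2 * δ)
          (fun u hu => by linarith [h.le_height hH hB ha hδ hu]) hpq
        linarith
    refine ⟨height w a (V 0), fun t => ?_⟩
    rcases lt_trichotomy t 0 with ht | rfl | ht
    · linarith [hgrow t 0 ht]
    · simp
    · linarith [hgrow 0 t ht]
  · rintro ⟨c, hc⟩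
    refine ⟨?_, ?_⟩
    · have key : ∀ s t : ℝ, s ≤ t → dist (V s) (V t) = t - s := by
        intro s t hst
        refine le_antisymm (hV.dist_le hst) ?_
        have := height_sub_le_dist hB ha (V t) (V s)
        rw [hc, hc, dist_comm] at this
        linarith
      intro s _ t _
      rcases le_total s t with hst | hst
      · rw [key s t hst, abs_sub_comm, abs_of_nonneg (sub_nonneg.2 hst)]
      · rw [dist_comm, key t s hst, abs_of_nonneg (sub_nonneg.2 hst)]
    · simp only [hc]
      exact tendsto_atTop_add_const_right _ c tendsto_id

end HP

end
end

section
/- Let δ ≥ 0 and let H be a proper, geodesically complete, δ-hyperbolic, Busemann space with a fixed base point w ∈ H and boundary point a ∈ ∂H. Then for every point x ∈ H there exists a vertical geodesic line V_x : ℝ → H whose image contains x. -/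
open Set Filter
open scoped ENNReal NNReal

noncomputable section

namespace HP

variable {H : Type*} [MetricSpace H]

variable {Hp Hq : Type*} [MetricSpace Hp] [MetricSpace Hq]

/-- Pointwise limits along the hyperfilter of asymptotically geodesic maps with a common value
exist in a proper space, and they are geodesic. -/
theorem exists_limit_geodesic [ProperSpace H] {x : H} {I : Set ℝ} (f : ℕ → ℝ → H)
    (hI : (0 : ℝ) ∈ I) (hf0 : ∀ n, f n 0 = x)
    (hf : ∀ s ∈ I, ∀ t ∈ I, ∀ᶠ n in atTop, dist (f n s) (f n t) = |s - t|) :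
    ∃ g : ℝ → H, IsGeodesicOn g I ∧
      ∀ t ∈ I, Tendsto (fun n => f n t) (hyperfilter ℕ : Filter ℕ) (nhds (g t)) := by
  have hle : (hyperfilter ℕ : Filter ℕ) ≤ atTop := Nat.hyperfilter_le_atTop
  have hlim : ∀ t : ℝ, ∃ y : H, t ∈ I →
      Tendsto (fun n => f n t) (hyperfilter ℕ : Filter ℕ) (nhds y) := by
    intro t
    by_cases ht : t ∈ I
    · have hball : ∀ᶠ n in (hyperfilter ℕ : Filter ℕ), f n t ∈ Metric.closedBall x |t| := by
        filter_upwards [hle (hf t ht 0 hI)] with n hn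
        rw [hf0, sub_zero] at hn
        exact hn.le
      obtain ⟨y, -, hy⟩ := (isCompact_closedBall x |t|).ultrafilter_le_nhds'
        ((hyperfilter ℕ).map (fun n => f n t)) hball
      exact ⟨y, fun _ => hy⟩
    · exact ⟨x, fun h => absurd h ht⟩
  choose g hg using hlim
  refine ⟨g, fun s hs t ht => ?_, hg⟩
  exact tendsto_nhds_unique_of_eventuallyEq ((hg s hs).dist (hg t ht)) tendsto_const_nhds
    (hle (hf s hs t ht))

/-- In a Busemann space, the distance between proportional points of two geodesic segments is
bounded by the interpolation of the distances between their endpoints. -/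
theorem BusemannSpace.dist_proportional_le (hB : BusemannSpace H) {γ γ' : ℝ → H} {l l' u : ℝ}
    (hl : 0 ≤ l) (hl' : 0 ≤ l') (hγ : IsGeodesicOn γ (Icc 0 l)) (hγ' : IsGeodesicOn γ' (Icc 0 l'))
    (hu : u ∈ Icc (0 : ℝ) 1) :
    dist (γ (u * l)) (γ' (u * l')) ≤
      (1 - u) * dist (γ 0) (γ' 0) + u * dist (γ l) (γ' l') := by
  have h := (hB.2 0 l 0 l' γ γ' hγ hγ').2 (x := (0, 0)) (y := (l, l'))
    ⟨⟨le_rfl, hl⟩, ⟨le_rfl, hl'⟩⟩ ⟨⟨hl, le_rfl⟩, ⟨hl', le_rfl⟩⟩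
    (sub_nonneg.2 hu.2) hu.1 (by ring)
  simpa using h

/-- In a Busemann space, asymptotic rays with the same origin coincide. -/
theorem BusemannSpace.ray_unique (hB : BusemannSpace H) {w : H} {k k' : ℝ → H}
    (hk : IsRayFrom w k) (hk' : IsRayFrom w k') (h : FinHausRays k k') {t : ℝ} (ht : 0 ≤ t) :
    k t = k' t := by
  obtain ⟨C, hC, -⟩ := h
  have hbdd : ∀ s : ℝ, 0 ≤ s → dist (k s) (k' s) ≤ 2 * C := by
    intro s hs
    obtain ⟨v, hv, hd⟩ := hC s hs
    have h1 : dist (k 0) (k s) = s := by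
      rw [hk.1 0 self_mem_Ici s hs, zero_sub, abs_neg, abs_of_nonneg hs]
    have h2 : dist (k 0) (k' v) = v := by
      rw [hk.2, ← hk'.2, hk'.1 0 self_mem_Ici v hv, zero_sub, abs_neg, abs_of_nonneg hv]
    have h3 : dist (k' v) (k' s) ≤ C := by
      rw [hk'.1 v hv s hs, abs_le]
      have h4 := dist_triangle (k 0) (k s) (k' v)
      have h5 := dist_triangle_right (k 0) (k s) (k' v)
      constructor <;> linarith
    linarith [dist_triangle (k s) (k' v) (k' s)]
  have hlin : ∀ᶠ T : ℝ in atTop, dist (k t) (k' t) ≤ t / T * (2 * C) := by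
    filter_upwards [eventually_ge_atTop t, eventually_gt_atTop 0] with T hT hT0
    have hu : t / T ∈ Icc (0 : ℝ) 1 := ⟨by positivity, (div_le_one hT0).2 hT⟩
    have h1 := hB.dist_proportional_le hT0.le hT0.le
      (fun s hs t ht => hk.1 s hs.1 t ht.1) (fun s hs t ht => hk'.1 s hs.1 t ht.1) hu
    rw [div_mul_cancel₀ t hT0.ne', hk.2, hk'.2, dist_self, mul_zero, zero_add] at h1
    exact h1.trans (mul_le_mul_of_nonneg_left (hbdd T hT0.le) hu.1)
  have hlim : Tendsto (fun T : ℝ => t / T * (2 * C)) atTop (nhds 0) := by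
    simpa using (tendsto_const_nhds (x := t)).div_atTop tendsto_id |>.mul_const (2 * C)
  exact dist_le_zero.1 (ge_of_tendsto hlim hlin)

/-- In a Busemann space the Busemann function is computed by the representing ray. -/
theorem BusemannSpace.busemann_eq (hB : BusemannSpace H) {w : H} {a : ℝ → H} (ha : IsRayFrom w a)
    (x : H) : busemann w a x = limsup (fun t => dist x (a t) - t) atTop := by
  have hset : { b : ℝ | ∃ k : ℝ → H, IsRayFrom w k ∧ FinHausRays a k ∧
      b = limsup (fun t => dist x (k t) - t) atTop } =
      {limsup (fun t => dist x (a t) - t) atTop} := by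
    ext b
    rw [mem_ofPred_eq, mem_singleton_iff]
    constructor
    · rintro ⟨k, hk, hak, rfl⟩
      refine limsup_congr ?_
      filter_upwards [eventually_ge_atTop 0] with t ht
      rw [hB.ray_unique ha hk hak ht]
    · rintro rfl
      exact ⟨a, ha, (finHaus_equivalence H).refl ⟨a, ha.1⟩, rfl⟩
  rw [busemann, hset, csSup_singleton]

/-- In a proper Busemann space every point is the origin of a ray which stays at bounded distance
from a given ray. -/
theorem BusemannSpace.exists_ray [ProperSpace H] (hB : BusemannSpace H) {w : H} {a : ℝ → H}
    (ha : IsRayFrom w a) (x : H) :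
    ∃ r : ℝ → H, IsRayFrom x r ∧ ∀ t : ℝ, 0 ≤ t → dist (r t) (a t) ≤ 2 * dist x w := by
  choose γ hγ using fun n : ℕ => hB.1 x (a n)
  have hwa : ∀ n : ℕ, dist w (a n) = n := fun n => by
    rw [← ha.2, ha.1 0 self_mem_Ici n (mem_Ici.2 (Nat.cast_nonneg n)), zero_sub, abs_neg, Nat.abs_cast]
  have hlen : ∀ n : ℕ, |dist x (a n) - n| ≤ dist x w := fun n => by
    have := abs_dist_sub_le x w (a n)
    rwa [hwa] at this
  have hlarge : ∀ t : ℝ, ∀ᶠ n : ℕ in atTop, t ≤ dist x (a n) ∧ 0 < dist x (a n) := fun t => by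
    filter_upwards [(tendsto_natCast_atTop_atTop (R := ℝ)).eventually_gt_atTop
      (|t| + dist x w)] with n hn
    have h1 := (abs_le.1 (hlen n)).1
    exact ⟨by linarith [le_abs_self t], by linarith [abs_nonneg t]⟩
  obtain ⟨r, hr, hlim⟩ := exists_limit_geodesic (x := x) (I := Ici 0) γ self_mem_Ici
    (fun n => (hγ n).2.1) (fun s hs t ht => by
      filter_upwards [hlarge s, hlarge t] with n h1 h2
      exact (hγ n).1 s ⟨hs, h1.1⟩ t ⟨ht, h2.1⟩)
  refine ⟨r, ⟨hr, ?_⟩, fun t ht => ?_⟩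
  · refine tendsto_nhds_unique (hlim 0 self_mem_Ici) ?_
    simp only [(hγ _).2.1, tendsto_const_nhds]
  refine le_of_tendsto ((hlim t ht).dist tendsto_const_nhds) (Nat.hyperfilter_le_atTop ?_)
  filter_upwards [hlarge t] with n ⟨htL, hL⟩
  have hu : t / dist x (a n) ∈ Icc (0 : ℝ) 1 := ⟨by positivity, (div_le_one hL).2 htL⟩
  have h1 := hB.dist_proportional_le hL.le (Nat.cast_nonneg n) (hγ n).1
    (fun s hs t ht => ha.1 s hs.1 t ht.1) hu
  rw [div_mul_cancel₀ t hL.ne', (hγ n).2.1, (hγ n).2.2, dist_self, mul_zero, add_zero, ha.2] at h1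
  have h2 : dist (a (t / dist x (a n) * n)) (a t) ≤ dist x w := by
    rw [ha.1 _ (mul_nonneg hu.1 (Nat.cast_nonneg n)) t ht]
    have h3 : t / dist x (a n) * n - t = -(t / dist x (a n) * (dist x (a n) - n)) := by
      rw [mul_sub, div_mul_cancel₀ t hL.ne']
      ring
    rw [h3, abs_neg, abs_mul, abs_of_nonneg hu.1]
    exact (mul_le_mul hu.2 (hlen n) (abs_nonneg _) zero_le_one).trans_eq (one_mul _)
  have h4 : (1 - t / dist x (a n)) * dist x w ≤ dist x w :=
    mul_le_of_le_one_left dist_nonneg (by linarith [hu.1])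
  linarith [dist_triangle (γ n t) (a (t / dist x (a n) * n)) (a t)]

/-- In a proper geodesically complete space every geodesic ray extends to a geodesic line. -/
theorem GeodesicallyComplete.exists_line [ProperSpace H] (hgc : GeodesicallyComplete H)
    {r : ℝ → H} (hr : IsGeodesicRay r) :
    ∃ V : ℝ → H, IsGeodesicLine V ∧ ∀ t : ℝ, 0 ≤ t → V t = r t := by
  choose L hL hLr using fun n : ℕ =>
    hgc 0 n r (Nat.cast_nonneg n) (fun s hs t ht => hr s hs.1 t ht.1)
  obtain ⟨V, hV, hlim⟩ := exists_limit_geodesic (x := r 0) (I := univ) L (mem_univ 0)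
    (fun n => hLr n 0 ⟨le_rfl, Nat.cast_nonneg n⟩)
    (fun s hs t ht => Eventually.of_forall fun n => hL n s hs t ht)
  refine ⟨V, hV, fun t ht => ?_⟩
  refine tendsto_nhds_unique_of_eventuallyEq (hlim t (mem_univ t)) tendsto_const_nhds
    (Nat.hyperfilter_le_atTop ?_)
  filter_upwards [(tendsto_natCast_atTop_atTop (R := ℝ)).eventually_ge_atTop t] with n hn
  exact hLr n t ⟨ht, hn⟩

/-- Along a ray at bounded distance from the representing ray, the height grows at unit speed up to
an additive constant. -/
theorem BusemannSpace.sub_le_height (hB : BusemannSpace H) {w : H} {a r : ℝ → H} {C : ℝ}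
    (ha : IsRayFrom w a) (hr : IsGeodesicRay r)
    (hC : ∀ t : ℝ, 0 ≤ t → dist (r t) (a t) ≤ C) {t : ℝ} (ht : 0 ≤ t) :
    t - C ≤ height w a (r t) := by
  have hlower : ∀ᶠ s : ℝ in atTop, -dist (r t) w ≤ dist (r t) (a s) - s := by
    filter_upwards [eventually_ge_atTop 0] with s hs
    have h1 : dist w (a s) = s := by
      rw [← ha.2, ha.1 0 self_mem_Ici s hs, zero_sub, abs_neg, abs_of_nonneg hs]
    linarith [dist_triangle_left w (a s) (r t)]
  have hupper : limsup (fun s => dist (r t) (a s) - s) atTop ≤ C - t := by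
    refine limsup_le_of_le (isCoboundedUnder_le_of_eventually_le _ hlower) ?_
    filter_upwards [eventually_ge_atTop t] with s hs
    have h1 : dist (r t) (r s) = s - t := by
      rw [hr t ht s (ht.trans hs), abs_sub_comm, abs_of_nonneg (sub_nonneg.2 hs)]
    linarith [dist_triangle (r t) (r s) (a s), hC s (ht.trans hs)]
  rw [height, hB.busemann_eq ha]
  linarith

/-- In a proper, geodesically complete, δ-hyperbolic Busemann space,
every point lies on a vertical geodesic line. -/
theorem statement2 {H : Type*} [MetricSpace H] [ProperSpace H]
    (δ : ℝ) (hδ : 0 ≤ δ) (hH : DeltaHyperbolic H δ) (hB : BusemannSpace H)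
    (hgc : GeodesicallyComplete H)
    (w : H) (a : ℝ → H) (ha : IsRayFrom w a) (x : H) :
    ∃ V : ℝ → H, IsVerticalGeodesic w a V ∧ ∃ t : ℝ, V t = x := by
  obtain ⟨r, hr, hra⟩ := hB.exists_ray ha x
  obtain ⟨V, hV, hVr⟩ := hgc.exists_line hr.1
  refine ⟨V, ⟨hV, ?_⟩, 0, (hVr 0 le_rfl).trans hr.2⟩
  refine tendsto_atTop_mono' atTop ?_ (tendsto_atTop_add_const_right atTop (-(2 * dist x w))
    tendsto_id)
  filter_upwards [eventually_ge_atTop 0] with t ht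
  rw [hVr t ht]
  exact hB.sub_le_height ha hr.1 hra ht

end HP

end
end
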